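/- arXiv:2004.12209 — 6 statements merged into one kernel-verified Lean document; each statement's English description precedes it below -/
import Mathlib

section
/- Let H be a real inner product space and let R : H → ℝ be a semi-norm, i.e., convex and absolutely homogeneous (R(α • f) = |α| · R(f) for all α ∈ ℝ, f ∈ H). Define N(f) := sqrt(‖f‖² + R(f)²). Then N is a norm on H, and N is strictly convex: whenever f ≠ 0, g ≠ 0, and N(f + g) = N(f) + N(g), there exists α ≥ 0 such that g = α • f. -/
open scoped RealInnerProductSpace

/-- A convex, absolutely homogeneous function is subadditive. -/
theorem ConvexOn.map_add_le_of_abs_homogeneous {E : Type*} [AddCommGroup E] [Module ℝ E]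
    {R : E → ℝ} (hconv : ConvexOn ℝ Set.univ R)
    (hhom : ∀ (α : ℝ) (f : E), R (α • f) = |α| * R f) (f g : E) :
    R (f + g) ≤ R f + R g := by
  have h := hconv.2 (Set.mem_univ f) (Set.mem_univ g) (by norm_num : (0 : ℝ) ≤ 1 / 2)
    (by norm_num : (0 : ℝ) ≤ 1 / 2) (by norm_num)
  rw [← smul_add, hhom, abs_of_pos (by norm_num : (0 : ℝ) < 1 / 2)] at h
  simp only [smul_eq_mul] at h
  linarith

/-- A convex, absolutely homogeneous function is nonnegative. -/
theorem ConvexOn.nonneg_of_abs_homogeneous {E : Type*} [AddCommGroup E] [Module ℝ E]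
    {R : E → ℝ} (hconv : ConvexOn ℝ Set.univ R)
    (hhom : ∀ (α : ℝ) (f : E), R (α • f) = |α| * R f) (f : E) : 0 ≤ R f := by
  have h := hconv.map_add_le_of_abs_homogeneous hhom f ((-1 : ℝ) • f)
  have h0 : R 0 = 0 := by simpa using hhom 0 0
  rw [hhom, neg_one_smul, add_neg_cancel, h0] at h
  norm_num at h
  exact h

/-- The Cauchy–Schwarz inequality in the plane. -/
theorem Real.mul_add_mul_le_sqrt_mul_sqrt (a b c d : ℝ) :
    a * c + b * d ≤ √(a ^ 2 + b ^ 2) * √(c ^ 2 + d ^ 2) := by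
  rw [← Real.sqrt_mul (by positivity)]
  apply Real.le_sqrt_of_sq_le
  nlinarith [sq_nonneg (a * d - b * c)]

/-- If `R` is a semi-norm (convex and absolutely homogeneous) on a real inner product space,
then `N f = sqrt (‖f‖² + R f²)` is a norm, and it is strictly convex. -/
theorem stmt3 {H : Type*} [NormedAddCommGroup H] [InnerProductSpace ℝ H]
    (R : H → ℝ)
    (hconv : ConvexOn ℝ Set.univ R)
    (hhom : ∀ (α : ℝ) (f : H), R (α • f) = |α| * R f)
    (N : H → ℝ) (hN : ∀ f : H, N f = Real.sqrt (‖f‖ ^ 2 + R f ^ 2)) :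
    (∀ f g : H, N (f + g) ≤ N f + N g) ∧
    (∀ (α : ℝ) (f : H), N (α • f) = |α| * N f) ∧
    (∀ f : H, N f = 0 → f = 0) ∧
    (∀ f g : H, f ≠ 0 → g ≠ 0 → N (f + g) = N f + N g → ∃ α : ℝ, 0 ≤ α ∧ g = α • f) := by
  have hsub := hconv.map_add_le_of_abs_homogeneous hhom
  have hR := hconv.nonneg_of_abs_homogeneous hhom
  have hN0 (f : H) : 0 ≤ N f := hN f ▸ Real.sqrt_nonneg _
  have hNsq (f : H) : N f ^ 2 = ‖f‖ ^ 2 + R f ^ 2 := by rw [hN, Real.sq_sqrt (by positivity)]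
  have hcs (f g : H) : ‖f‖ * ‖g‖ + R f * R g ≤ N f * N g := by
    rw [hN, hN]
    exact Real.mul_add_mul_le_sqrt_mul_sqrt _ _ _ _
  have hadd (f g : H) : N (f + g) ^ 2 ≤ N f ^ 2 + N g ^ 2 + 2 * (⟪f, g⟫ + R f * R g) := by
    have hsq := pow_le_pow_left₀ (hR (f + g)) (hsub f g) 2
    rw [hNsq, hNsq, hNsq, norm_add_sq_real]
    linarith
  refine ⟨fun f g => ?_, fun α f => ?_, fun f hf => ?_, fun f g hf _ h => ?_⟩
  · refine (pow_le_pow_iff_left₀ (hN0 _) (add_nonneg (hN0 f) (hN0 g)) two_ne_zero).1 ?_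
    linarith [hadd f g, hcs f g, real_inner_le_norm f g, add_sq (N f) (N g)]
  · rw [hN, hN, hhom, norm_smul, Real.norm_eq_abs, mul_pow, mul_pow, ← mul_add,
      Real.sqrt_mul (sq_nonneg _), Real.sqrt_sq (abs_nonneg α)]
  · have hsq := hNsq f
    rw [hf] at hsq
    exact norm_eq_zero.1 (pow_eq_zero_iff two_ne_zero |>.1
      (by linarith [sq_nonneg ‖f‖, sq_nonneg (R f)]))
  · have hle := hadd f g
    rw [h] at hle
    have hinner : ⟪f, g⟫ = ‖f‖ * ‖g‖ :=
      (real_inner_le_norm f g).antisymm (by linarith [hcs f g, add_sq (N f) (N g)])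
    rw [inner_eq_norm_mul_iff_real] at hinner
    refine ⟨‖f‖⁻¹ * ‖g‖, by positivity, ?_⟩
    rw [mul_smul, hinner, inv_smul_smul₀ (norm_ne_zero_iff.2 hf)]
end

section
/- Let B be a real reflexive Banach space whose norm is strictly convex. Then for every continuous linear functional F on B there exists a unique f ∈ B such that ‖f‖ = ‖F‖ (where ‖F‖ is the dual norm) and F(f) = ‖F‖². -/
/-- In a reflexive space every continuous linear functional has a norming vector. -/
theorem exists_norm_eq_norm_and_apply_eq_sq {B : Type*} [NormedAddCommGroup B] [NormedSpace ℝ B]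
    (hrefl : Function.Surjective (NormedSpace.inclusionInDoubleDual ℝ B)) (F : B →L[ℝ] ℝ) :
    ∃ f : B, ‖f‖ = ‖F‖ ∧ F f = ‖F‖ ^ 2 := by
  by_cases hF : ‖F‖ = 0
  · exact ⟨0, by simp [hF], by simp [hF]⟩
  · obtain ⟨φ, hφ, hφF⟩ := exists_dual_vector ℝ F hF
    obtain ⟨u, rfl⟩ := hrefl φ
    have hu : ‖u‖ = 1 := ((NormedSpace.inclusionInDoubleDualLi ℝ).norm_map u).symm.trans hφ
    have hFu : F u = ‖F‖ := by simpa using hφF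
    exact ⟨‖F‖ • u, by simp [norm_smul, hu], by simp [hFu, sq]⟩

/-- In a strictly convex space a continuous linear functional has at most one norming vector
of the same norm. -/
theorem eq_of_norm_eq_norm_of_apply_eq_sq {B : Type*} [NormedAddCommGroup B] [NormedSpace ℝ B]
    (hsc : ∀ f g : B, f ≠ 0 → g ≠ 0 → ‖f + g‖ = ‖f‖ + ‖g‖ → ∃ α : ℝ, 0 ≤ α ∧ g = α • f)
    {F : B →L[ℝ] ℝ} {f g : B} (hf : ‖f‖ = ‖F‖) (hFf : F f = ‖F‖ ^ 2)
    (hg : ‖g‖ = ‖F‖) (hFg : F g = ‖F‖ ^ 2) : g = f := by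
  rcases (norm_nonneg F).eq_or_lt' with hF | hF
  · rw [norm_eq_zero.mp (hf.trans hF), norm_eq_zero.mp (hg.trans hF)]
  · have hadd : ‖f + g‖ = ‖f‖ + ‖g‖ := by
      refine le_antisymm (norm_add_le f g) (le_of_mul_le_mul_left ?_ hF)
      calc ‖F‖ * (‖f‖ + ‖g‖) = F (f + g) := by rw [map_add, hFf, hFg, hf, hg]; ring
        _ ≤ ‖F‖ * ‖f + g‖ := (le_abs_self _).trans (F.le_opNorm _)
    obtain ⟨α, -, rfl⟩ := hsc f g (norm_pos_iff.mp (hf ▸ hF)) (norm_pos_iff.mp (hg ▸ hF)) hadd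
    rw [map_smul, hFf, smul_eq_mul, mul_eq_right₀ (pow_pos hF 2).ne'] at hFg
    rw [hFg, one_smul]

/-- Riesz-type representation in a reflexive, strictly convex Banach space: every continuous
linear functional `F` has a unique `f` with `‖f‖ = ‖F‖` and `F f = ‖F‖²`. -/
theorem stmt4 {B : Type*} [NormedAddCommGroup B] [NormedSpace ℝ B] [CompleteSpace B]
    (hrefl : Function.Surjective (NormedSpace.inclusionInDoubleDual ℝ B))
    (hsc : ∀ f g : B, f ≠ 0 → g ≠ 0 → ‖f + g‖ = ‖f‖ + ‖g‖ → ∃ α : ℝ, 0 ≤ α ∧ g = α • f) :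
    ∀ F : B →L[ℝ] ℝ, ∃! f : B, ‖f‖ = ‖F‖ ∧ F f = ‖F‖ ^ 2 := by
  intro F
  obtain ⟨f, hf, hFf⟩ := exists_norm_eq_norm_and_apply_eq_sq hrefl F
  exact ⟨f, ⟨hf, hFf⟩, fun g hg => eq_of_norm_eq_norm_of_apply_eq_sq hsc hf hFf hg.1 hg.2⟩
end

section
/- Let H be a real Hilbert space, let R : H → ℝ be convex, absolutely homogeneous (R(α • f) = |α| · R(f) for all α ∈ ℝ, f ∈ H), and lower semicontinuous, and let L : H → ℝ be a nonzero continuous linear functional. Then the supremum of L over the set B := {h ∈ H : ‖h‖² + R(h)² ≤ 1} is attained at a unique point h₀; moreover this maximizer satisfies ‖h₀‖² + R(h₀)² = 1 and L(h₀) > 0. -/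
open scoped RealInnerProductSpace
open Filter Topology

section

variable {H : Type*} [NormedAddCommGroup H] [InnerProductSpace ℝ H] {R : H → ℝ}

/-- An absolutely homogeneous convex function is subadditive. -/
theorem apply_add_le_of_convexOn_of_abs_homogeneous (hconv : ConvexOn ℝ Set.univ R)
    (hhom : ∀ (α : ℝ) (f : H), R (α • f) = |α| * R f) (f g : H) :
    R (f + g) ≤ R f + R g := by
  have h := hconv.2 (Set.mem_univ f) (Set.mem_univ g)
    (by norm_num : (0 : ℝ) ≤ 1 / 2) (by norm_num : (0 : ℝ) ≤ 1 / 2) (by norm_num)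
  rw [← smul_add, hhom, abs_of_pos (by norm_num : (0 : ℝ) < 1 / 2)] at h
  simp only [smul_eq_mul] at h
  linarith

/-- An absolutely homogeneous convex function is nonnegative. -/
theorem nonneg_of_convexOn_of_abs_homogeneous (hconv : ConvexOn ℝ Set.univ R)
    (hhom : ∀ (α : ℝ) (f : H), R (α • f) = |α| * R f) (f : H) : 0 ≤ R f := by
  have h := apply_add_le_of_convexOn_of_abs_homogeneous hconv hhom f ((-1 : ℝ) • f)
  have h0 := hhom 0 f
  rw [hhom] at h
  simp only [neg_smul, one_smul, add_neg_cancel, abs_neg, abs_one, one_mul] at h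
  simp only [zero_smul, abs_zero, zero_mul] at h0
  linarith

/-- The parallelogram inequality for `‖·‖² + R²`. -/
theorem norm_add_sq_add_sq_le (hconv : ConvexOn ℝ Set.univ R)
    (hhom : ∀ (α : ℝ) (f : H), R (α • f) = |α| * R f) (f g : H) :
    ‖f + g‖ ^ 2 + R (f + g) ^ 2 + ‖f - g‖ ^ 2 ≤
      2 * (‖f‖ ^ 2 + R f ^ 2) + 2 * (‖g‖ ^ 2 + R g ^ 2) := by
  have hp := parallelogram_law_with_norm ℝ f g
  have hadd := apply_add_le_of_convexOn_of_abs_homogeneous hconv hhom f g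
  have hsq := pow_le_pow_left₀ (nonneg_of_convexOn_of_abs_homogeneous hconv hhom (f + g)) hadd 2
  nlinarith [sq_nonneg (R f - R g)]

theorem norm_smul_sq_add_sq (hhom : ∀ (α : ℝ) (f : H), R (α • f) = |α| * R f) (c : ℝ) (h : H) :
    ‖c • h‖ ^ 2 + R (c • h) ^ 2 = c ^ 2 * (‖h‖ ^ 2 + R h ^ 2) := by
  rw [hhom, norm_smul, Real.norm_eq_abs, mul_pow, mul_pow, sq_abs]
  ring

theorem norm_inv_sqrt_smul_sq_add_sq (hhom : ∀ (α : ℝ) (f : H), R (α • f) = |α| * R f)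
    {h : H} (hh : h ≠ 0) :
    ‖(√(‖h‖ ^ 2 + R h ^ 2))⁻¹ • h‖ ^ 2 + R ((√(‖h‖ ^ 2 + R h ^ 2))⁻¹ • h) ^ 2 = 1 := by
  have hq : 0 < ‖h‖ ^ 2 + R h ^ 2 := by positivity
  rw [norm_smul_sq_add_sq hhom, inv_pow, Real.sq_sqrt hq.le, inv_mul_cancel₀ (ne_of_gt hq)]

/-- A bound for `L` on the unit ball of `‖·‖² + R²` extends by homogeneity. -/
theorem apply_le_mul_sqrt (hhom : ∀ (α : ℝ) (f : H), R (α • f) = |α| * R f)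
    {L : H →L[ℝ] ℝ} {M : ℝ} (hM : ∀ h : H, ‖h‖ ^ 2 + R h ^ 2 ≤ 1 → L h ≤ M) (h : H) :
    L h ≤ M * √(‖h‖ ^ 2 + R h ^ 2) := by
  rcases eq_or_ne h 0 with rfl | hh
  · have h0 : R 0 = 0 := by simpa using hhom 0 0
    simp [h0]
  · have hq : 0 < √(‖h‖ ^ 2 + R h ^ 2) := Real.sqrt_pos.2 (by positivity)
    have hb := hM _ (norm_inv_sqrt_smul_sq_add_sq hhom hh).le
    rwa [map_smul, smul_eq_mul, inv_mul_le_iff₀ hq, mul_comm] at hb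

theorem exists_norm_sq_add_sq_le_one_and_pos (hhom : ∀ (α : ℝ) (f : H), R (α • f) = |α| * R f)
    {L : H →L[ℝ] ℝ} (hL : L ≠ 0) : ∃ h : H, ‖h‖ ^ 2 + R h ^ 2 ≤ 1 ∧ 0 < L h := by
  obtain ⟨x, hx⟩ : ∃ x, L x ≠ 0 := by
    by_contra! hx
    exact hL (ContinuousLinearMap.ext hx)
  obtain ⟨y, hy⟩ : ∃ y, 0 < L y := by
    rcases hx.lt_or_gt with hneg | hpos
    · exact ⟨-x, by simpa using hneg⟩
    · exact ⟨x, hpos⟩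
  have hy0 : y ≠ 0 := by
    rintro rfl
    simp at hy
  refine ⟨_, (norm_inv_sqrt_smul_sq_add_sq hhom hy0).le, ?_⟩
  rw [map_smul, smul_eq_mul]
  positivity

/-- Points of the unit ball of `‖·‖² + R²` at which `L` is almost maximal are close together. -/
theorem dist_le_sqrt_of_apply_le (hconv : ConvexOn ℝ Set.univ R)
    (hhom : ∀ (α : ℝ) (f : H), R (α • f) = |α| * R f) {L : H →L[ℝ] ℝ} {M : ℝ} (hMpos : 0 < M)
    (hM : ∀ h : H, ‖h‖ ^ 2 + R h ^ 2 ≤ 1 → L h ≤ M) {f g : H}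
    (hf : ‖f‖ ^ 2 + R f ^ 2 ≤ 1) (hg : ‖g‖ ^ 2 + R g ^ 2 ≤ 1) (hfg : 0 ≤ L f + L g) :
    dist f g ≤ √(4 - ((L f + L g) / M) ^ 2) := by
  have hle := apply_le_mul_sqrt hhom hM (f + g)
  rw [map_add, mul_comm, ← div_le_iff₀ hMpos] at hle
  have hsq := pow_le_pow_left₀ (by positivity) hle 2
  rw [Real.sq_sqrt (by positivity)] at hsq
  have hp := norm_add_sq_add_sq_le hconv hhom f g
  rw [dist_eq_norm]
  exact Real.le_sqrt_of_sq_le (by linarith)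

theorem isClosed_norm_sq_add_sq_le_one (hconv : ConvexOn ℝ Set.univ R)
    (hhom : ∀ (α : ℝ) (f : H), R (α • f) = |α| * R f) (hlsc : LowerSemicontinuous R) :
    IsClosed {h : H | ‖h‖ ^ 2 + R h ^ 2 ≤ 1} := by
  have hsq : LowerSemicontinuous fun h => R h ^ 2 := by
    have hmono : Monotone fun x : ℝ => max x 0 ^ 2 := fun x y hxy => by
      dsimp only
      gcongr
    have hcomp := Continuous.comp_lowerSemicontinuous (g := fun x : ℝ => max x 0 ^ 2)
      (by fun_prop) hlsc hmono
    have heq : (fun x : ℝ => max x 0 ^ 2) ∘ R = fun h => R h ^ 2 := funext fun h => by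
      simp [max_eq_left (nonneg_of_convexOn_of_abs_homogeneous hconv hhom h)]
    rwa [heq] at hcomp
  have hnorm : LowerSemicontinuous fun h : H => ‖h‖ ^ 2 :=
    Continuous.lowerSemicontinuous (by fun_prop)
  exact (hnorm.add hsq).isClosed_preimage 1

theorem exists_isMaxOn_norm_sq_add_sq_le_one [CompleteSpace H] (hconv : ConvexOn ℝ Set.univ R)
    (hhom : ∀ (α : ℝ) (f : H), R (α • f) = |α| * R f) (hlsc : LowerSemicontinuous R)
    {L : H →L[ℝ] ℝ} (hL : L ≠ 0) :
    ∃ h₀ : H, ‖h₀‖ ^ 2 + R h₀ ^ 2 ≤ 1 ∧ ∀ h : H, ‖h‖ ^ 2 + R h ^ 2 ≤ 1 → L h ≤ L h₀ := by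
  obtain ⟨y, hy, hLy⟩ := exists_norm_sq_add_sq_le_one_and_pos hhom hL
  set B : Set H := {h | ‖h‖ ^ 2 + R h ^ 2 ≤ 1}
  have hbdd : BddAbove (L '' B) := by
    refine ⟨‖L‖, ?_⟩
    rintro _ ⟨h, hh, rfl⟩
    have hh' : ‖h‖ ^ 2 + R h ^ 2 ≤ 1 := hh
    have hn : ‖h‖ ≤ 1 := by nlinarith [sq_nonneg (R h), norm_nonneg h]
    exact (le_abs_self _).trans (L.unit_le_opNorm h hn)
  set M := sSup (L '' B) with hMdef
  have hM : ∀ h : H, ‖h‖ ^ 2 + R h ^ 2 ≤ 1 → L h ≤ M := fun h hh => le_csSup hbdd ⟨h, hh, rfl⟩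
  have hMpos : 0 < M := hLy.trans_le (hM y hy)
  obtain ⟨v, -, hv, hvB⟩ := exists_seq_tendsto_sSup (Set.Nonempty.image L ⟨y, hy⟩) hbdd
  choose u huB hu using hvB
  rw [← hMdef, ← funext hu] at hv
  have hsum : Tendsto (fun n : ℕ × ℕ => L (u n.1) + L (u n.2)) atTop (𝓝 (M + M)) := by
    rw [← prod_atTop_atTop_eq]
    exact (hv.comp tendsto_fst).add (hv.comp tendsto_snd)
  have hcauchy : CauchySeq u := by
    rw [cauchySeq_iff_tendsto_dist_atTop_0]
    have hlim : Tendsto (fun n : ℕ × ℕ => √(4 - ((L (u n.1) + L (u n.2)) / M) ^ 2)) atTop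
        (𝓝 0) := by
      have h := (((hsum.div_const M).pow 2).const_sub 4).sqrt
      have hzero : 4 - ((M + M) / M) ^ 2 = 0 := by
        field_simp
        norm_num
      rwa [hzero, Real.sqrt_zero] at h
    refine squeeze_zero' (Eventually.of_forall fun _ => dist_nonneg) ?_ hlim
    filter_upwards [hsum.eventually_const_le (show 0 < M + M by positivity)] with n hn
    exact dist_le_sqrt_of_apply_le hconv hhom hMpos hM (huB n.1) (huB n.2) hn
  obtain ⟨h₀, hh₀⟩ := cauchySeq_tendsto_of_complete hcauchy
  have hLh₀ : L h₀ = M := tendsto_nhds_unique ((L.continuous.tendsto h₀).comp hh₀) hv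
  exact ⟨h₀, (isClosed_norm_sq_add_sq_le_one hconv hhom hlsc).mem_of_tendsto hh₀
    (Eventually.of_forall huB), fun h hh => hLh₀ ▸ hM h hh⟩

end

/-- For a semi-norm regularizer `R` and a nonzero continuous linear functional `L` on a real
Hilbert space, the supremum of `L` over `{h : ‖h‖² + R h² ≤ 1}` is attained at a unique point,
which lies on the boundary and has positive value of `L`. -/
theorem stmt5 {H : Type*} [NormedAddCommGroup H] [InnerProductSpace ℝ H] [CompleteSpace H]
    (R : H → ℝ)
    (hconv : ConvexOn ℝ Set.univ R)
    (hhom : ∀ (α : ℝ) (f : H), R (α • f) = |α| * R f)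
    (hlsc : LowerSemicontinuous R)
    (L : H →L[ℝ] ℝ) (hL : L ≠ 0) :
    (∃! h₀ : H, ‖h₀‖ ^ 2 + R h₀ ^ 2 ≤ 1 ∧
        ∀ h : H, ‖h‖ ^ 2 + R h ^ 2 ≤ 1 → L h ≤ L h₀) ∧
    (∀ h₀ : H, (‖h₀‖ ^ 2 + R h₀ ^ 2 ≤ 1 ∧
        ∀ h : H, ‖h‖ ^ 2 + R h ^ 2 ≤ 1 → L h ≤ L h₀) →
      ‖h₀‖ ^ 2 + R h₀ ^ 2 = 1 ∧ 0 < L h₀) := by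
  obtain ⟨y, hy, hLy⟩ := exists_norm_sq_add_sq_le_one_and_pos hhom hL
  refine ⟨?_, ?_⟩
  · obtain ⟨h₀, hh₀, hmax⟩ := exists_isMaxOn_norm_sq_add_sq_le_one hconv hhom hlsc hL
    refine ⟨h₀, ⟨hh₀, hmax⟩, fun g ⟨hg, hgmax⟩ => ?_⟩
    have hpos : 0 < L h₀ := hLy.trans_le (hmax y hy)
    have heq : L g = L h₀ := le_antisymm (hmax g hg) (hgmax h₀ hh₀)
    have hd := dist_le_sqrt_of_apply_le hconv hhom hpos hmax hg hh₀ (by linarith)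
    have hzero : 4 - ((L g + L h₀) / L h₀) ^ 2 = 0 := by
      rw [heq]
      field_simp
      norm_num
    rw [hzero, Real.sqrt_zero] at hd
    exact dist_le_zero.1 hd
  · rintro h₀ ⟨hh₀, hmax⟩
    have hpos : 0 < L h₀ := hLy.trans_le (hmax y hy)
    refine ⟨le_antisymm hh₀ ?_, hpos⟩
    exact Real.one_le_sqrt.1 ((le_mul_iff_one_le_right hpos).1 (apply_le_mul_sqrt hhom hmax h₀))
end

section
/- Let H be a real Hilbert space, m ∈ ℕ, z : Fin m → H, and let K be the m × m Gram matrix with K i j = ⟨z i, z j⟩. Let k ∈ H with k ≠ 0, and let w : Fin m → ℝ be given by w i = ⟨z i, k⟩. Then: (i) the matrix I + K is positive definite, hence invertible; (ii) the scalar c := ⟨k, k⟩ − wᵀ (I + K)⁻¹ w is strictly positive; (iii) the vector h* := c^{-1/2} • (k − Σ_i ((I + K)⁻¹ w) i • z i) is the unique maximizer of h ↦ ⟨h, k⟩ over the set {h ∈ H : ‖h‖² + Σ_i ⟨z i, h⟩² ≤ 1}, and the maximum value equals √c. -/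
open scoped RealInnerProductSpace
open Matrix

/-- If `⟪z i, u⟫ = a i` where `u = k - ∑ i, a i • z i`, then `u` represents `⟪·, k⟫` for the warped
inner product `⟪x, y⟫ + ∑ i, ⟪z i, x⟫ * ⟪z i, y⟫`. -/
lemma inner_add_sum_inner_mul_eq {ι H : Type*} [Fintype ι] [NormedAddCommGroup H]
    [InnerProductSpace ℝ H] {z : ι → H} {a : ι → ℝ} {k u : H}
    (hu : u = k - ∑ i, a i • z i) (ha : ∀ i, ⟪z i, u⟫ = a i) (h : H) :
    ⟪h, u⟫ + ∑ i, ⟪z i, h⟫ * ⟪z i, u⟫ = ⟪h, k⟫ := by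
  simp only [ha]
  rw [hu, inner_sub_right, inner_sum]
  simp only [real_inner_smul_right, real_inner_comm h, mul_comm (a _)]
  ring

/-- Expansion of the square of a difference for the warped inner product. -/
lemma norm_sub_sq_add_sum_inner_sub_sq {ι H : Type*} [Fintype ι] [NormedAddCommGroup H]
    [InnerProductSpace ℝ H] (z : ι → H) (x y : H) :
    ‖x - y‖ ^ 2 + ∑ i, ⟪z i, x - y⟫ ^ 2 =
      (‖x‖ ^ 2 + ∑ i, ⟪z i, x⟫ ^ 2) - 2 * (⟪x, y⟫ + ∑ i, ⟪z i, x⟫ * ⟪z i, y⟫) +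
        (‖y‖ ^ 2 + ∑ i, ⟪z i, y⟫ ^ 2) := by
  simp only [norm_sub_sq_real, inner_sub_right, sub_sq, Finset.sum_add_distrib,
    Finset.sum_sub_distrib, mul_assoc, ← Finset.mul_sum]
  ring

/-- Closed-form solution of the RKHS-warped polar optimization: with Gram matrix `K` of the
invariance functionals `z` and `w i = ⟪z i, k⟫`, the matrix `I + K` is positive definite,
`c = ⟪k, k⟫ - wᵀ(I+K)⁻¹w > 0`, and `hstar = c^{-1/2} • (k - Σ_i ((I+K)⁻¹w) i • z i)` is the
unique maximizer of `⟪·, k⟫` over `{h : ‖h‖² + Σ_i ⟪z i, h⟫² ≤ 1}`, with maximum `√c`. -/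
theorem stmt6 {H : Type*} [NormedAddCommGroup H] [InnerProductSpace ℝ H] [CompleteSpace H]
    (m : ℕ) (z : Fin m → H)
    (K : Matrix (Fin m) (Fin m) ℝ) (hK : ∀ i j, K i j = ⟪z i, z j⟫)
    (k : H) (hk : k ≠ 0)
    (w : Fin m → ℝ) (hw : ∀ i, w i = ⟪z i, k⟫) :
    (1 + K).PosDef ∧ IsUnit (1 + K) ∧
    0 < ⟪k, k⟫ - w ⬝ᵥ ((1 + K)⁻¹ *ᵥ w) ∧
    (∀ c : ℝ, c = ⟪k, k⟫ - w ⬝ᵥ ((1 + K)⁻¹ *ᵥ w) →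
      ∀ hstar : H, hstar = (Real.sqrt c)⁻¹ • (k - ∑ i, ((1 + K)⁻¹ *ᵥ w) i • z i) →
        (‖hstar‖ ^ 2 + ∑ i, ⟪z i, hstar⟫ ^ 2 ≤ 1) ∧
        (∀ h : H, ‖h‖ ^ 2 + ∑ i, ⟪z i, h⟫ ^ 2 ≤ 1 → ⟪h, k⟫ ≤ ⟪hstar, k⟫) ∧
        (∀ h : H, ‖h‖ ^ 2 + ∑ i, ⟪z i, h⟫ ^ 2 ≤ 1 → ⟪h, k⟫ = ⟪hstar, k⟫ → h = hstar) ∧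
        ⟪hstar, k⟫ = Real.sqrt c) := by
  have hKgram : K = Matrix.gram ℝ z := by
    ext i j
    simp [hK, Matrix.gram]
  have hpos : (1 + K).PosDef := by
    rw [hKgram]
    exact Matrix.PosDef.one.add_posSemidef (Matrix.posSemidef_gram ℝ z)
  set a := (1 + K)⁻¹ *ᵥ w with ha_def
  set u := k - ∑ i, a i • z i with hu
  have hsolve : (1 + K) *ᵥ a = w := by
    rw [ha_def, Matrix.mulVec_mulVec,
      Matrix.mul_nonsing_inv _ ((Matrix.isUnit_iff_isUnit_det _).1 hpos.isUnit), Matrix.one_mulVec]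
  have hzu : ∀ i, ⟪z i, u⟫ = a i := by
    intro i
    have hi := congrFun hsolve i
    rw [Matrix.add_mulVec, Matrix.one_mulVec, Pi.add_apply, hw i] at hi
    simp only [Matrix.mulVec, dotProduct, hK] at hi
    rw [hu, inner_sub_right, inner_sum]
    simp only [real_inner_smul_right, mul_comm (a _)]
    linarith
  have hrep := inner_add_sum_inner_mul_eq hu hzu
  have hcu : ⟪k, k⟫ - w ⬝ᵥ a = ⟪u, k⟫ := by
    rw [hu, inner_sub_left, sum_inner]
    simp only [real_inner_smul_left, ← hw, dotProduct, mul_comm (a _)]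
  have hu_sq : ‖u‖ ^ 2 + ∑ i, ⟪z i, u⟫ ^ 2 = ⟪u, k⟫ := by
    rw [← hrep u, real_inner_self_eq_norm_sq]
    simp only [sq]
  have hu_ne : u ≠ 0 := by
    intro h0
    have hkk := hrep k
    simp only [h0, inner_zero_right, mul_zero, Finset.sum_const_zero, add_zero] at hkk
    exact hk (inner_self_eq_zero.1 hkk.symm)
  have hc_pos : 0 < ⟪u, k⟫ := by
    rw [← hu_sq]
    have := norm_pos_iff.2 hu_ne
    positivity
  refine ⟨hpos, hpos.isUnit, hcu ▸ hc_pos, ?_⟩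
  intro c hc hstar hstar_eq
  rw [hcu] at hc
  rw [← hc] at hc_pos hu_sq
  have hs : 0 < √c := Real.sqrt_pos.2 hc_pos
  have hss : √c ^ 2 = c := Real.sq_sqrt hc_pos.le
  have hval : ⟪hstar, k⟫ = √c := by
    rw [hstar_eq, real_inner_smul_left, ← hc]
    field_simp
    exact hss.symm
  have hnorm : ‖hstar‖ ^ 2 + ∑ i, ⟪z i, hstar⟫ ^ 2 = 1 := by
    rw [hstar_eq]
    simp only [norm_smul, real_inner_smul_right, mul_pow, ← Finset.mul_sum, Real.norm_eq_abs,
      sq_abs]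
    rw [← mul_add, hu_sq, inv_pow, hss, inv_mul_cancel₀ hc_pos.ne']
  have hstar_rep : ∀ h, ⟪h, hstar⟫ + ∑ i, ⟪z i, h⟫ * ⟪z i, hstar⟫ = (√c)⁻¹ * ⟪h, k⟫ := by
    intro h
    rw [hstar_eq, ← hrep h]
    simp only [real_inner_smul_right, mul_add, Finset.mul_sum, mul_left_comm]
  have hdist : ∀ h : H, ‖h‖ ^ 2 + ∑ i, ⟪z i, h⟫ ^ 2 ≤ 1 →
      ‖h - hstar‖ ^ 2 ≤ 2 - 2 * ((√c)⁻¹ * ⟪h, k⟫) := by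
    intro h hh
    have hexp := norm_sub_sq_add_sum_inner_sub_sq z h hstar
    rw [hstar_rep, hnorm] at hexp
    have : 0 ≤ ∑ i, ⟪z i, h - hstar⟫ ^ 2 := Finset.sum_nonneg fun i _ => sq_nonneg _
    linarith
  refine ⟨hnorm.le, fun h hh => ?_, fun h hh heq => ?_, hval⟩
  · have hle : (√c)⁻¹ * ⟪h, k⟫ ≤ 1 := by linarith [hdist h hh, sq_nonneg ‖h - hstar‖]
    rw [hval]
    simpa using (inv_mul_le_iff₀ hs).1 hle
  · have hle := hdist h hh
    rw [heq, hval, inv_mul_cancel₀ hs.ne'] at hle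
    have hzero : ‖h - hstar‖ ^ 2 = 0 := le_antisymm (by linarith) (sq_nonneg _)
    exact sub_eq_zero.1 (norm_eq_zero.1 (pow_eq_zero_iff two_ne_zero |>.1 hzero))
end

section
/- Let d ∈ ℕ, let J : ℝ^d → ℝ be continuous with J(x) ≥ 0 and J(α • x) = α² · J(x) for all x ∈ ℝ^d and all α ≥ 0, and let a ∈ ℝ^d with a ≠ 0. Then a point x ∈ ℝ^d is an optimal solution of the problem P: maximize ⟨a, y⟩ subject to J(y) ≤ 1 (i.e., J(x) ≤ 1 and ⟨a, y⟩ ≤ ⟨a, x⟩ for all y with J(y) ≤ 1) if and only if J(x) = 1, c := ⟨a, x⟩ > 0, and x/c is an optimal solution of the problem Q: minimize J(y) subject to ⟨a, y⟩ = 1 (i.e., ⟨a, x/c⟩ = 1 and J(x/c) ≤ J(y) for all y with ⟨a, y⟩ = 1). -/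
open scoped RealInnerProductSpace

/-- A maximizer of a linear functional over `{J ≤ 1}`, with positive value and `J` positively
homogeneous of degree two, satisfies the constraint with equality. -/
theorem eq_one_of_isMax_inner {E : Type*} [NormedAddCommGroup E] [InnerProductSpace ℝ E]
    {J : E → ℝ} (hnn : ∀ x, 0 ≤ J x)
    (hhom : ∀ (α : ℝ) (x : E), 0 ≤ α → J (α • x) = α ^ 2 * J x) {a x : E}
    (hx : J x ≤ 1) (hmax : ∀ y, J y ≤ 1 → ⟪a, y⟫ ≤ ⟪a, x⟫) (hpos : 0 < ⟪a, x⟫) :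
    J x = 1 := by
  by_contra hne
  have hlt : J x < 1 := lt_of_le_of_ne hx hne
  have h0 := hnn x
  -- The rescaled point `(2 / (1 + J x)) • x` is feasible and has a larger value.
  have hfeas : J ((2 / (1 + J x)) • x) ≤ 1 := by
    rw [hhom _ _ (by positivity), div_pow, div_mul_eq_mul_div, div_le_one (by positivity)]
    nlinarith [sq_nonneg (1 - J x)]
  have hle := hmax _ hfeas
  rw [real_inner_smul_right] at hle
  have hscale : 1 < 2 / (1 + J x) := by
    rw [one_lt_div (by positivity)]
    linarith
  nlinarith

/-- Equivalence between a constrained linear maximization `P` and a gauge minimization `Q`: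
`x` maximizes `⟪a, ·⟫` over `{J ≤ 1}` iff `J x = 1`, `c = ⟪a, x⟫ > 0`, and `x / c`
minimizes `J` over `{⟪a, ·⟫ = 1}`. -/
theorem stmt13 (d : ℕ) (J : EuclideanSpace ℝ (Fin d) → ℝ)
    (hcont : Continuous J) (hnn : ∀ x, 0 ≤ J x)
    (hhom : ∀ (α : ℝ) (x : EuclideanSpace ℝ (Fin d)), 0 ≤ α → J (α • x) = α ^ 2 * J x)
    (a : EuclideanSpace ℝ (Fin d)) (ha : a ≠ 0)
    (x : EuclideanSpace ℝ (Fin d)) :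
    (J x ≤ 1 ∧ ∀ y, J y ≤ 1 → ⟪a, y⟫ ≤ ⟪a, x⟫) ↔
    (J x = 1 ∧ 0 < ⟪a, x⟫ ∧ ⟪a, (⟪a, x⟫)⁻¹ • x⟫ = 1 ∧
      ∀ y, ⟪a, y⟫ = 1 → J ((⟪a, x⟫)⁻¹ • x) ≤ J y) := by
  constructor
  · rintro ⟨hx, hmax⟩
    have hpos : 0 < ⟪a, x⟫ := by
      have hJa := hnn a
      have hfeas : J ((1 / (1 + J a)) • a) ≤ 1 := by
        rw [hhom _ _ (by positivity), div_pow, div_mul_eq_mul_div, div_le_one (by positivity)]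
        nlinarith
      refine lt_of_lt_of_le ?_ (hmax _ hfeas)
      rw [real_inner_smul_right]
      exact mul_pos (by positivity) (real_inner_self_pos.mpr ha)
    have hJx : J x = 1 := eq_one_of_isMax_inner hnn hhom hx hmax hpos
    refine ⟨hJx, hpos, ?_, fun y hy => ?_⟩
    · rw [real_inner_smul_right, inv_mul_cancel₀ hpos.ne']
    · have hinner : ⟪a, ⟪a, x⟫ • y⟫ = ⟪a, x⟫ := by rw [real_inner_smul_right, hy, mul_one]
      have hone : 1 ≤ J (⟪a, x⟫ • y) := by
        by_contra! hlt
        exact hlt.ne (eq_one_of_isMax_inner hnn hhom hlt.le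
          (by rwa [hinner]) (by rwa [hinner]))
      rw [hhom _ _ hpos.le] at hone
      rw [hhom _ _ (inv_nonneg.mpr hpos.le), hJx, mul_one, inv_pow]
      exact (inv_le_iff_one_le_mul₀' (by positivity)).mpr hone
  · rintro ⟨hJx, hpos, -, hmin⟩
    refine ⟨hJx.le, fun y hy => ?_⟩
    by_contra! hlt
    have hy_pos : 0 < ⟪a, y⟫ := hpos.trans hlt
    have hle := hmin (⟪a, y⟫⁻¹ • y) (by rw [real_inner_smul_right, inv_mul_cancel₀ hy_pos.ne'])
    rw [hhom _ _ (inv_nonneg.mpr hpos.le), hhom _ _ (inv_nonneg.mpr hy_pos.le), hJx,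
      mul_one] at hle
    have hinv : ⟪a, y⟫⁻¹ ^ 2 < ⟪a, x⟫⁻¹ ^ 2 := by gcongr
    nlinarith [sq_nonneg ⟪a, y⟫⁻¹]
end

section
/- Let (E, ‖·‖) be a real normed space and let [·,·] : E × E → ℝ satisfy, for all f, g, h ∈ E and λ ∈ ℝ: additivity in the first argument [f+g, h] = [f, h] + [g, h]; homogeneity [λ f, g] = λ [f, g] = [f, λ g]; norm-inducing [f, f] = ‖f‖²; and the Cauchy–Schwarz inequality [f, g] ≤ ‖f‖ · ‖g‖. If in addition [·,·] is additive in its second argument, i.e., [f, g + h] = [f, g] + [f, h] for all f, g, h, then [·,·] is symmetric ([f, g] = [g, f] for all f, g) and is an inner product on E inducing the norm ‖·‖ (in particular ‖·‖ satisfies the parallelogram law ‖f+g‖² + ‖f−g‖² = 2‖f‖² + 2‖g‖²). -/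
/-- A semi-inner-product that is additive in its second argument is symmetric and is an inner
product inducing the norm; in particular the norm satisfies the parallelogram law. -/
theorem stmt15 {E : Type*} [NormedAddCommGroup E] [NormedSpace ℝ E]
    (sip : E → E → ℝ)
    (hadd1 : ∀ f g h : E, sip (f + g) h = sip f h + sip g h)
    (hhom1 : ∀ (c : ℝ) (f g : E), sip (c • f) g = c * sip f g)
    (hhom2 : ∀ (c : ℝ) (f g : E), sip f (c • g) = c * sip f g)
    (hnorm : ∀ f : E, sip f f = ‖f‖ ^ 2)
    (hcs : ∀ f g : E, sip f g ≤ ‖f‖ * ‖g‖)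
    (hadd2 : ∀ f g h : E, sip f (g + h) = sip f g + sip f h) :
    (∀ f g : E, sip f g = sip g f) ∧
    (∀ f g : E, ‖f + g‖ ^ 2 + ‖f - g‖ ^ 2 = 2 * ‖f‖ ^ 2 + 2 * ‖g‖ ^ 2) := by
  have cauchy_schwarz_sq (f g : E) : sip f g ^ 2 ≤ sip f f * sip g g := by
    have hneg := hcs ((-1 : ℝ) • f) g
    rw [hhom1, norm_smul] at hneg
    norm_num at hneg
    rw [hnorm, hnorm, ← mul_pow]
    exact sq_le_sq' (by linarith) (hcs f g)
  -- Cauchy–Schwarz for `f` and `s • f + t • g` is a quadratic inequality in `s, t` whose linear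
  -- term in `t` must vanish.
  have self_mul_sub_eq_zero (f g : E) : sip f f * (sip f g - sip g f) = 0 := by
    have key (s t : ℝ) : t * s * (sip f f * (sip f g - sip g f)) ≤
        t ^ 2 * (sip f f * sip g g - sip f g ^ 2) := by
      have h := cauchy_schwarz_sq f (s • f + t • g)
      simp only [hadd1, hadd2, hhom1, hhom2] at h
      linarith
    set d := sip f f * (sip f g - sip g f)
    set k := sip f f * sip g g - sip f g ^ 2
    have hd : d ^ 2 ≤ 0 := by linarith [key (k + 1) d]
    exact pow_eq_zero_iff two_ne_zero |>.mp (le_antisymm hd (sq_nonneg d))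
  refine ⟨fun f g => ?_, fun f g => ?_⟩
  · rcases mul_eq_zero.mp (self_mul_sub_eq_zero f g) with h | h
    · have hf : f = 0 := by simpa [hnorm] using h
      have hleft : sip 0 g = 0 := by simpa using hhom1 0 0 g
      have hright : sip g 0 = 0 := by simpa using hhom2 0 g 0
      rw [hf, hleft, hright]
    · exact sub_eq_zero.mp h
  · have hsub : f - g = f + (-1 : ℝ) • g := by simp [sub_eq_add_neg]
    simp only [← hnorm, hsub, hadd1, hadd2, hhom1, hhom2]
    ring
end
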